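/- Let n ≥ 2 and let r ≥ 2 be an integer. Suppose g is a pseudo-Riemannian metric of class C^r on an open set U ⊆ ℝ^n, ḡ is a pseudo-Riemannian metric of class C^2 on U, and g and ḡ are geodesically related via a continuous 1-form ψ. Then ḡ is of class C^r on U. -/

import Mathlib

noncomputable section
open scoped BigOperators

/-- Partial derivative `∂_i f` of `f : ℝⁿ → ℝ` in the `i`-th coordinate direction. -/
def pd {n : ℕ} (i : Fin n) (f : (Fin n → ℝ) → ℝ) (x : Fin n → ℝ) : ℝ :=
  fderiv ℝ f x (Pi.single i 1)

/-- The matrix `(g_{ij}(x))` of a two-index family of functions at a point `x`. -/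
def matAt {n : ℕ} (g : Fin n → Fin n → (Fin n → ℝ) → ℝ) (x : Fin n → ℝ) :
    Matrix (Fin n) (Fin n) ℝ := Matrix.of fun i j => g i j x

/-- The components `g^{ij}(x)` of the pointwise inverse matrix. -/
def ginv {n : ℕ} (g : Fin n → Fin n → (Fin n → ℝ) → ℝ) (i j : Fin n) (x : Fin n → ℝ) : ℝ :=
  (matAt g x)⁻¹ i j

/-- `g` is a pseudo-Riemannian metric of class `C^r` on `U`: the components are
symmetric, of class `C^r`, and the matrix `(g_{ij}(x))` is invertible for every `x ∈ U`. -/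
structure IsMetric {n : ℕ} (r : WithTop ℕ∞) (g : Fin n → Fin n → (Fin n → ℝ) → ℝ)
    (U : Set (Fin n → ℝ)) : Prop where
  symm : ∀ i j, ∀ x ∈ U, g i j x = g j i x
  contDiff : ∀ i j, ContDiffOn ℝ r (g i j) U
  inv : ∀ x ∈ U, IsUnit (matAt g x).det

/-- Christoffel symbols `Γ^h_{ij} = (1/2) g^{hk}(∂_i g_{jk} + ∂_j g_{ik} − ∂_k g_{ij})`. -/
def Christoffel {n : ℕ} (g : Fin n → Fin n → (Fin n → ℝ) → ℝ) (h i j : Fin n)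
    (x : Fin n → ℝ) : ℝ :=
  (1/2) * ∑ k, ginv g h k x * (pd i (g j k) x + pd j (g i k) x - pd k (g i j) x)

/-- `g` and `gbar` are geodesically related via the 1-form `ψ`:
`Γ̄^h_{ij} = Γ^h_{ij} + ψ_i δ^h_j + ψ_j δ^h_i` on `U`. -/
def GeodesicallyRelated {n : ℕ} (g gbar : Fin n → Fin n → (Fin n → ℝ) → ℝ)
    (ψ : Fin n → (Fin n → ℝ) → ℝ) (U : Set (Fin n → ℝ)) : Prop :=
  ∀ h i j, ∀ x ∈ U, Christoffel gbar h i j x =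
    Christoffel g h i j x + ψ i x * (if h = j then (1:ℝ) else 0)
      + ψ j x * (if h = i then (1:ℝ) else 0)

section Calculus

open Set Filter Topology

/-- Mean value inequality on the segment `[0, a]`. -/
lemma abs_sub_sub_mul_le_of_hasDerivAt {φ φ' : ℝ → ℝ} {a c ε : ℝ}
    (hφ : ∀ t ∈ uIcc 0 a, HasDerivAt φ (φ' t) t) (hb : ∀ t ∈ uIcc 0 a, |φ' t - c| ≤ ε) :
    |φ a - φ 0 - a * c| ≤ ε * |a| := by
  have key := (convex_uIcc (0 : ℝ) a).norm_image_sub_le_of_norm_hasDerivWithin_le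
    (f := fun t => φ t - t * c) (f' := fun t => φ' t - 1 * c)
    (fun t ht => ((hφ t ht).sub ((hasDerivAt_id' t).mul_const c)).hasDerivWithinAt)
    (C := ε) (fun t ht => by simpa using hb t ht) left_mem_uIcc right_mem_uIcc
  simp only [Real.norm_eq_abs, zero_mul, sub_zero] at key
  convert key using 2
  ring

lemma abs_le_of_mem_uIcc_zero {t a : ℝ} (h : t ∈ uIcc 0 a) : |t| ≤ |a| := by
  simpa using abs_sub_left_of_mem_uIcc h

lemma hasDerivAt_comp_add_smul {E : Type*} [NormedAddCommGroup E] [NormedSpace ℝ E]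
    {f : E → ℝ} {x u : E} {t : ℝ} (hf : DifferentiableAt ℝ f (x + t • u)) :
    HasDerivAt (fun s : ℝ => f (x + s • u)) (fderiv ℝ f (x + t • u) u) t := by
  have h : HasDerivAt (fun s : ℝ => x + s • u) u t := by
    simpa using ((hasDerivAt_id t).smul_const u).const_add x
  exact hf.hasFDerivAt.comp_hasDerivAt t h

/-- Schwarz's theorem in its strong form: if `∂_u f = F` on an open set and `∂_v F` exists and is
continuous, then `∂_u ∂_v f` exists and equals `∂_v F`. -/
lemma hasDerivAt_fderiv_apply_of_fderiv_eq {E : Type*} [NormedAddCommGroup E] [NormedSpace ℝ E]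
    {U : Set E} (hU : IsOpen U) {f F : E → ℝ} {u v : E} (hf : DifferentiableOn ℝ f U)
    (hF : DifferentiableOn ℝ F U) (hfF : ∀ y ∈ U, fderiv ℝ f y u = F y)
    (hc : ContinuousOn (fun y => fderiv ℝ F y v) U) {x : E} (hx : x ∈ U) :
    HasDerivAt (fun t : ℝ => fderiv ℝ f (x + t • u) v) (fderiv ℝ F x v) 0 := by
  have dfa : ∀ y ∈ U, DifferentiableAt ℝ f y := fun y hy => hf.differentiableAt (hU.mem_nhds hy)
  have dFa : ∀ y ∈ U, DifferentiableAt ℝ F y := fun y hy => hF.differentiableAt (hU.mem_nhds hy)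
  rw [hasDerivAt_iff_isLittleO, Asymptotics.isLittleO_iff]
  intro ε hε
  have hnear : ∀ᶠ y in 𝓝 x, y ∈ U ∧ |fderiv ℝ F y v - fderiv ℝ F x v| ≤ ε := by
    refine (hU.eventually_mem hx).and ?_
    have := (hc.continuousAt (hU.mem_nhds hx)).eventually (Metric.closedBall_mem_nhds _ hε)
    filter_upwards [this] with y hy
    simpa [Real.dist_eq] using hy
  obtain ⟨δ, hδ, hball⟩ := Metric.eventually_nhds_iff_ball.1 hnear
  have hin : ∀ t s : ℝ, |t| * ‖u‖ + |s| * ‖v‖ < δ → x + t • u + s • v ∈ Metric.ball x δ := by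
    intro t s hts
    rw [Metric.mem_ball, dist_eq_norm]
    calc ‖x + t • u + s • v - x‖ = ‖t • u + s • v‖ := by congr 1; abel
      _ ≤ ‖t • u‖ + ‖s • v‖ := norm_add_le _ _
      _ = |t| * ‖u‖ + |s| * ‖v‖ := by simp [norm_smul]
      _ < δ := hts
  have hin0 : ∀ t : ℝ, |t| * ‖u‖ < δ → x + t • u ∈ Metric.ball x δ := by
    intro t ht
    simpa using hin t 0 (by simpa using ht)
  have hΔ : ∀ t s : ℝ, |t| * ‖u‖ + |s| * ‖v‖ < δ →
      |(f (x + t • u + s • v) - f (x + t • u)) - (f (x + s • v) - f x)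
        - t * (s * fderiv ℝ F x v)| ≤ ε * |s| * |t| := by
    intro t s hts
    have h0 : 0 ≤ |s| * ‖v‖ := by positivity
    have hlt : ∀ t' ∈ uIcc 0 t, |t'| * ‖u‖ + |s| * ‖v‖ < δ := fun t' ht' =>
      (add_le_add_left (mul_le_mul_of_nonneg_right (abs_le_of_mem_uIcc_zero ht')
        (norm_nonneg u)) _).trans_lt hts
    have := abs_sub_sub_mul_le_of_hasDerivAt (a := t) (c := s * fderiv ℝ F x v) (ε := ε * |s|)
      (φ := fun t' => f (x + s • v + t' • u) - f (x + t' • u))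
      (φ' := fun t' => F (x + s • v + t' • u) - F (x + t' • u)) ?_ ?_
    · simpa [add_right_comm x (s • v)] using this
    · intro t' ht'
      have h1 : x + s • v + t' • u ∈ U := by
        rw [add_right_comm]; exact (hball _ (hin t' s (hlt t' ht'))).1
      have h2 : x + t' • u ∈ U := (hball _ (hin0 t' (by linarith [hlt t' ht']))).1
      rw [← hfF _ h1, ← hfF _ h2]
      exact (hasDerivAt_comp_add_smul (dfa _ h1)).sub (hasDerivAt_comp_add_smul (dfa _ h2))
    · intro t' ht'
      have hs' : ∀ s' ∈ uIcc 0 s, x + t' • u + s' • v ∈ Metric.ball x δ := fun s' hs' =>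
        hin t' s' ((add_le_add_right (mul_le_mul_of_nonneg_right (abs_le_of_mem_uIcc_zero hs')
          (norm_nonneg v)) _).trans_lt (hlt t' ht'))
      have := abs_sub_sub_mul_le_of_hasDerivAt (a := s) (c := fderiv ℝ F x v) (ε := ε)
        (φ := fun s' => F (x + t' • u + s' • v))
        (fun s' h => hasDerivAt_comp_add_smul (dFa _ (hball _ (hs' s' h)).1))
        (fun s' h => (hball _ (hs' s' h)).2)
      simpa [add_right_comm x (s • v)] using this
  have hsmall : ∀ᶠ t : ℝ in 𝓝 0, |t| * ‖u‖ < δ := by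
    have : Tendsto (fun t : ℝ => |t| * ‖u‖) (𝓝 0) (𝓝 (|0| * ‖u‖)) := by
      apply Continuous.tendsto; fun_prop
    exact this.eventually_lt_const (by simpa using hδ)
  filter_upwards [hsmall] with t ht
  have hslope : ∀ y ∈ U, Tendsto (fun s : ℝ => s⁻¹ * (f (y + s • v) - f y)) (𝓝[≠] 0)
      (𝓝 (fderiv ℝ f y v)) := by
    intro y hy
    have := (hasDerivAt_comp_add_smul (f := f) (x := y) (u := v) (t := 0)
      (by simpa using dfa y hy)).tendsto_slope_zero
    simpa using this
  have hlim := (((hslope _ (hball _ (hin0 t ht)).1).sub (hslope x hx)).sub_const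
    (t * fderiv ℝ F x v)).abs
  have hsm : ∀ᶠ s : ℝ in 𝓝[≠] 0, |t| * ‖u‖ + |s| * ‖v‖ < δ := by
    have : Tendsto (fun s : ℝ => |t| * ‖u‖ + |s| * ‖v‖) (𝓝 0) (𝓝 (|t| * ‖u‖ + |0| * ‖v‖)) := by
      apply Continuous.tendsto; fun_prop
    exact (this.eventually_lt_const (by simpa using ht)).filter_mono nhdsWithin_le_nhds
  have := le_of_tendsto (b := ε * |t|) hlim (by
    filter_upwards [hsm, self_mem_nhdsWithin] with s hs hs0
    have hs0 : s ≠ 0 := hs0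
    have hpos : 0 < |s| := abs_pos.2 hs0
    rw [← mul_le_mul_iff_right₀ hpos, ← abs_mul]
    refine le_of_eq_of_le (congrArg abs ?_) ((hΔ t s hs).trans_eq (by ring))
    field_simp)
  simpa using this

/-- A function on an open subset of `ℝⁿ` with continuous partial derivatives is differentiable. -/
lemma hasFDerivAt_of_continuousOn_partial {n : ℕ} {U : Set (Fin n → ℝ)} (hU : IsOpen U)
    {f : (Fin n → ℝ) → ℝ} {D : Fin n → (Fin n → ℝ) → ℝ}
    (hD : ∀ i, ∀ y ∈ U, HasDerivAt (fun t : ℝ => f (y + t • Pi.single i 1)) (D i y) 0)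
    (hc : ∀ i, ContinuousOn (D i) U) {x : Fin n → ℝ} (hx : x ∈ U) :
    HasFDerivAt f (∑ i, D i x • ContinuousLinearMap.proj (R := ℝ) (φ := fun _ : Fin n => ℝ) i)
      x := by
  rw [hasFDerivAt_iff_isLittleO_nhds_zero, Asymptotics.isLittleO_iff]
  intro ε' hε'
  obtain ⟨ε, hε, hεn⟩ : ∃ ε : ℝ, 0 < ε ∧ ε * n ≤ ε' :=
    ⟨ε' / (n + 1), by positivity, by
      rw [div_mul_eq_mul_div, div_le_iff₀ (by positivity)]; nlinarith⟩
  have hnear : ∀ᶠ y in 𝓝 x, y ∈ U ∧ ∀ i, |D i y - D i x| ≤ ε := by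
    refine (hU.eventually_mem hx).and (eventually_all.2 fun i => ?_)
    have := ((hc i).continuousAt (hU.mem_nhds hx)).eventually (Metric.closedBall_mem_nhds _ hε)
    filter_upwards [this] with y hy
    simpa [Real.dist_eq] using hy
  obtain ⟨δ, hδ, hball⟩ := Metric.eventually_nhds_iff_ball.1 hnear
  filter_upwards [Metric.ball_mem_nhds (0 : Fin n → ℝ) hδ] with v hv
  have hv : ‖v‖ < δ := by simpa using hv
  have key : ∀ S : Finset (Fin n),
      |f (x + S.piecewise v 0) - f x - ∑ i ∈ S, D i x * v i| ≤ ∑ i ∈ S, ε * |v i| := by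
    intro S
    induction S using Finset.induction_on with
    | empty => simp
    | insert i S hi ih =>
      have hw : ∀ t : ℝ, |t| ≤ |v i| →
          x + S.piecewise v 0 + t • Pi.single i 1 ∈ Metric.ball x δ := by
        intro t ht
        rw [Metric.mem_ball, dist_eq_norm, add_assoc, add_sub_cancel_left]
        refine lt_of_le_of_lt ((pi_norm_le_iff_of_nonneg (norm_nonneg v)).2 fun j => ?_) hv
        refine le_trans ?_ (norm_le_pi_norm v j)
        by_cases hj : j = i
        · subst hj; simpa [hi] using ht
        · by_cases hjS : j ∈ S <;> simp [hj, hjS]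
      have hstep := abs_sub_sub_mul_le_of_hasDerivAt (a := v i) (c := D i x) (ε := ε)
        (φ := fun t => f (x + S.piecewise v 0 + t • Pi.single i 1))
        (φ' := fun t => D i (x + S.piecewise v 0 + t • Pi.single i 1))
        (fun t ht => by
          have h := hD i _ (hball _ (hw t (abs_le_of_mem_uIcc_zero ht))).1
          have h2 : HasDerivAt (fun s : ℝ => s - t) 1 t := (hasDerivAt_id' t).sub_const t
          have h3 := HasDerivAt.comp t (h₂ := fun s : ℝ =>
            f (x + S.piecewise v 0 + t • Pi.single i 1 + s • Pi.single i 1))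
            (by simpa using h) h2
          simp only [mul_one] at h3
          refine h3.congr_of_eventuallyEq (Eventually.of_forall fun s => ?_)
          simp only [Function.comp]
          congr 1
          rw [add_assoc _ (t • _), ← add_smul]
          simp)
        (fun t ht => (hball _ (hw t (abs_le_of_mem_uIcc_zero ht))).2 i)
      have hins : x + (insert i S).piecewise v 0
          = x + S.piecewise v 0 + v i • Pi.single i 1 := by
        rw [add_assoc]
        congr 1
        ext j
        by_cases hj : j = i
        · subst hj; simp [hi]
        · by_cases hjS : j ∈ S <;> simp [hj, hjS]
      rw [Finset.sum_insert hi, Finset.sum_insert hi, hins]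
      simp only [zero_smul, add_zero] at hstep
      calc _ = |(f (x + S.piecewise v 0 + v i • Pi.single i 1) - f (x + S.piecewise v 0)
              - v i * D i x) + (f (x + S.piecewise v 0) - f x - ∑ i ∈ S, D i x * v i)| := by
            congr 1; ring
        _ ≤ _ := (abs_add_le _ _).trans (add_le_add hstep ih)
  have := key Finset.univ
  simp only [Finset.piecewise_univ] at this
  have hsum : ∑ i, ε * |v i| ≤ ε' * ‖v‖ := by
    calc ∑ i, ε * |v i| ≤ ∑ _i : Fin n, ε * ‖v‖ :=
          Finset.sum_le_sum fun i _ => mul_le_mul_of_nonneg_left (norm_le_pi_norm v i) hε.le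
      _ = ε * n * ‖v‖ := by simp; ring
      _ ≤ _ := mul_le_mul_of_nonneg_right hεn (norm_nonneg v)
  simpa using this.trans hsum

end Calculus

section PartialDerivatives

variable {n : ℕ} {U : Set (Fin n → ℝ)} {f f₁ f₂ : (Fin n → ℝ) → ℝ} {x : Fin n → ℝ}

lemma ContDiffOn.differentiableAt_of_isOpen {m : ℕ} (hU : IsOpen U) (hm : 1 ≤ m)
    (hf : ContDiffOn ℝ m f U) (hx : x ∈ U) : DifferentiableAt ℝ f x :=
  (hf.contDiffAt (hU.mem_nhds hx)).differentiableAt (by exact_mod_cast (by lia : m ≠ 0))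

lemma ContDiffOn.pd {m : ℕ} (hU : IsOpen U) (hf : ContDiffOn ℝ (m + 1 : ℕ) f U) (i : Fin n) :
    ContDiffOn ℝ m (pd i f) U :=
  (hf.fderiv_of_isOpen hU (by norm_cast)).clm_apply contDiffOn_const

lemma fderiv_eq_sum_pd (f : (Fin n → ℝ) → ℝ) (x : Fin n → ℝ) :
    fderiv ℝ f x = ∑ i, pd i f x • ContinuousLinearMap.proj (R := ℝ) (φ := fun _ : Fin n => ℝ) i := by
  ext v
  conv_lhs => rw [pi_eq_sum_univ' v]
  simp [pd, mul_comm]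

lemma contDiffOn_succ_of_pd {m : ℕ} (hU : IsOpen U) (hf : DifferentiableOn ℝ f U)
    (h : ∀ i, ContDiffOn ℝ m (pd i f) U) : ContDiffOn ℝ (m + 1 : ℕ) f U := by
  push_cast
  refine (contDiffOn_succ_iff_fderiv_of_isOpen hU).2 ⟨hf, by simp, ?_⟩
  rw [funext (fderiv_eq_sum_pd f)]
  exact ContDiffOn.sum fun i _ => (h i).smul contDiffOn_const

/-- A function whose partial derivatives exist and are of class `C^m` is of class `C^{m+1}`. -/
lemma contDiffOn_succ_of_partial {m : ℕ} (hU : IsOpen U) {D : Fin n → (Fin n → ℝ) → ℝ}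
    (hD : ∀ i, ∀ y ∈ U, HasDerivAt (fun t : ℝ => f (y + t • Pi.single i 1)) (D i y) 0)
    (hc : ∀ i, ContDiffOn ℝ m (D i) U) : ContDiffOn ℝ (m + 1 : ℕ) f U := by
  have hF := fun x (hx : x ∈ U) =>
    hasFDerivAt_of_continuousOn_partial hU hD (fun i => (hc i).continuousOn) hx
  refine contDiffOn_succ_of_pd hU (fun x hx => (hF x hx).differentiableAt.differentiableWithinAt)
    fun i => (hc i).congr fun x hx => ?_
  simp [pd, (hF x hx).fderiv, Pi.single_apply]

lemma pd_congr (hU : IsOpen U) (h : ∀ y ∈ U, f₁ y = f₂ y) (hx : x ∈ U) (i : Fin n) :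
    pd i f₁ x = pd i f₂ x := by
  rw [pd, pd, Filter.EventuallyEq.fderiv_eq (Filter.eventually_of_mem (hU.mem_nhds hx) h)]

lemma pd_add (i : Fin n) (h₁ : DifferentiableAt ℝ f₁ x) (h₂ : DifferentiableAt ℝ f₂ x) :
    pd i (fun y => f₁ y + f₂ y) x = pd i f₁ x + pd i f₂ x := by
  simp [pd, fderiv_fun_add h₁ h₂]

lemma pd_mul (i : Fin n) (h₁ : DifferentiableAt ℝ f₁ x) (h₂ : DifferentiableAt ℝ f₂ x) :
    pd i (fun y => f₁ y * f₂ y) x = pd i f₁ x * f₂ x + f₁ x * pd i f₂ x := by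
  simp [pd, fderiv_fun_mul h₁ h₂]
  ring

lemma pd_const_mul (i : Fin n) (c : ℝ) (h : DifferentiableAt ℝ f x) :
    pd i (fun y => c * f y) x = c * pd i f x := by
  simp [pd, fderiv_const_mul h]

lemma pd_sum {ι : Type*} [Fintype ι] (i : Fin n) {F : ι → (Fin n → ℝ) → ℝ}
    (h : ∀ k, DifferentiableAt ℝ (F k) x) :
    pd i (fun y => ∑ k, F k y) x = ∑ k, pd i (F k) x := by
  simp [pd, fderiv_fun_sum fun k _ => h k]

lemma pd_comm (hU : IsOpen U) (hf : ContDiffOn ℝ 2 f U) (hx : x ∈ U) (i j : Fin n) :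
    pd i (pd j f) x = pd j (pd i f) x := by
  have hc := hf.contDiffAt (hU.mem_nhds hx)
  have hsymm := hc.isSymmSndFDerivAt (by simp)
  have hd : DifferentiableAt ℝ (fderiv ℝ f) x :=
    (hc.fderiv_right (m := 1) (by norm_num)).differentiableAt (by norm_num)
  have key : ∀ k l : Fin n, pd k (pd l f) x
      = fderiv ℝ (fderiv ℝ f) x (Pi.single k 1) (Pi.single l 1) := by
    intro k l
    unfold pd
    rw [fderiv_clm_apply hd (differentiableAt_const _)]
    simp
  rw [key, key]
  exact hsymm _ _

/-- If the trace-free part of the Jacobian of a `C^1` vector field on an open subset of `ℝⁿ`,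
`n ≥ 2`, is of class `C^m` with `m ≥ 1`, then the vector field is of class `C^{m+1}`. -/
lemma contDiffOn_succ_of_traceFree_pd {m : ℕ} (hm : 1 ≤ m) (hn : 2 ≤ n) (hU : IsOpen U)
    {v : Fin n → (Fin n → ℝ) → ℝ} (hv : ∀ i, DifferentiableOn ℝ (v i) U)
    (hoff : ∀ i l, i ≠ l → ContDiffOn ℝ m (pd l (v i)) U)
    (hdiag : ∀ i j, ContDiffOn ℝ m (fun y => pd i (v i) y - pd j (v j) y) U) (i : Fin n) :
    ContDiffOn ℝ (m + 1 : ℕ) (v i) U := by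
  obtain ⟨k, rfl⟩ : ∃ k, m = k + 1 := ⟨m - 1, by lia⟩
  have hswap : ∀ i l, i ≠ l → ∀ y ∈ U, HasDerivAt
      (fun t : ℝ => pd i (v i) (y + t • Pi.single l 1)) (pd i (pd l (v i)) y) 0 := by
    intro i l hil y hy
    refine hasDerivAt_fderiv_apply_of_fderiv_eq hU (hv i)
      ((hoff i l hil).differentiableOn (by norm_cast)) (fun _ _ => rfl) ?_ hy
    exact ((hoff i l hil).pd hU i).continuousOn
  refine contDiffOn_succ_of_pd hU (hv i) fun l => ?_
  rcases ne_or_eq i l with hil | rfl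
  · exact hoff i l hil
  obtain ⟨j, hj⟩ : ∃ j : Fin n, j ≠ i := by
    have : Nontrivial (Fin n) := Fin.nontrivial_iff_two_le.2 hn
    exact exists_ne i
  refine contDiffOn_succ_of_partial hU (D := fun l y => if l = i then
    pd j (pd i (v j)) y + pd i (fun y => pd i (v i) y - pd j (v j) y) y
    else pd i (pd l (v i)) y) (fun l y hy => ?_) fun l => ?_
  · by_cases hl : l = i
    · subst hl
      simp only [if_true]
      have h1 := hasDerivAt_comp_add_smul (x := y) (u := Pi.single l 1) (t := 0)
        (f := fun y => pd l (v l) y - pd j (v j) y)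
        (by simpa using (hdiag l j).differentiableAt_of_isOpen hU hm hy)
      simp only [zero_smul, add_zero] at h1
      refine ((hswap j l hj y hy).add h1).congr_of_eventuallyEq (.of_forall fun t => ?_)
      simp
    · simpa [hl] using hswap i l (Ne.symm hl) y hy
  · by_cases hl : l = i
    · simpa [hl] using ((hoff j i hj).pd hU j).add ((hdiag i j).pd hU i)
    · simpa [hl] using (hoff i l (Ne.symm hl)).pd hU i

end PartialDerivatives

section Metric

variable {n : ℕ} {U : Set (Fin n → ℝ)} {g : Fin n → Fin n → (Fin n → ℝ) → ℝ}

lemma IsMetric.of_le {r s : WithTop ℕ∞} (hg : IsMetric r g U) (hs : s ≤ r) : IsMetric s g U :=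
  ⟨hg.symm, fun i j => (hg.contDiff i j).of_le hs, hg.inv⟩

lemma contDiffOn_det {r : WithTop ℕ∞} {A : (Fin n → ℝ) → Matrix (Fin n) (Fin n) ℝ}
    (hA : ∀ i j, ContDiffOn ℝ r (fun x => A x i j) U) : ContDiffOn ℝ r (fun x => (A x).det) U := by
  simp only [Matrix.det_apply']
  exact ContDiffOn.sum fun σ _ => contDiffOn_const.mul (contDiffOn_prod fun i _ => hA _ _)

lemma IsMetric.contDiffOn_ginv {r : WithTop ℕ∞} (hg : IsMetric r g U) (i j : Fin n) :
    ContDiffOn ℝ r (ginv g i j) U := by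
  have h : ginv g i j = fun x => ((matAt g x).det)⁻¹ *
      ((matAt g x).updateRow j (Pi.single i 1)).det := by
    ext x
    simp [ginv, Matrix.inv_def, Matrix.adjugate_apply]
  rw [h]
  refine ((contDiffOn_det fun k l => hg.contDiff k l).inv fun x hx => (hg.inv x hx).ne_zero).mul
    (contDiffOn_det fun k l => ?_)
  by_cases hk : k = j
  · subst hk
    simpa using contDiffOn_const
  · simpa [Matrix.updateRow_apply, hk, matAt] using hg.contDiff k l

lemma IsMetric.sum_ginv_mul {r : WithTop ℕ∞} (hg : IsMetric r g U) {x : Fin n → ℝ} (hx : x ∈ U)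
    (i k : Fin n) : ∑ j, ginv g i j x * g j k x = if i = k then 1 else 0 := by
  have := congrFun (congrFun (Matrix.nonsing_inv_mul _ (hg.inv x hx)) i) k
  simpa [Matrix.mul_apply, Matrix.one_apply, matAt, ginv] using this

lemma IsMetric.sum_mul_ginv {r : WithTop ℕ∞} (hg : IsMetric r g U) {x : Fin n → ℝ} (hx : x ∈ U)
    (i k : Fin n) : ∑ j, g i j x * ginv g j k x = if i = k then 1 else 0 := by
  have := congrFun (congrFun (Matrix.mul_nonsing_inv _ (hg.inv x hx)) i) k
  simpa [Matrix.mul_apply, Matrix.one_apply, matAt, ginv] using this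

lemma IsMetric.contDiffOn_christoffel {m : ℕ} (hU : IsOpen U) (hg : IsMetric (m + 1 : ℕ) g U)
    (h i j : Fin n) : ContDiffOn ℝ m (Christoffel g h i j) U := by
  have hpd := fun i j k => (hg.contDiff i j).pd hU k
  exact contDiffOn_const.mul (ContDiffOn.sum fun k _ =>
    ((hg.contDiffOn_ginv h k).of_le (by norm_cast; lia)).mul
      (((hpd _ _ _).add (hpd _ _ _)).sub (hpd _ _ _)))

lemma IsMetric.sum_christoffel_mul {r : WithTop ℕ∞} (hg : IsMetric r g U) {x : Fin n → ℝ}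
    (hx : x ∈ U) (i j k : Fin n) : ∑ h, Christoffel g h k i x * g h j x =
      (1 / 2) * (pd k (g i j) x + pd i (g k j) x - pd j (g k i) x) := by
  simp only [Christoffel, mul_assoc, Finset.sum_mul, ← Finset.mul_sum]
  congr 1
  rw [Finset.sum_comm]
  have : ∀ p, ∑ h, ginv g h p x * ((pd k (g i p) x + pd i (g k p) x - pd p (g k i) x) * g h j x)
      = (if j = p then 1 else 0) * (pd k (g i p) x + pd i (g k p) x - pd p (g k i) x) := by
    intro p
    rw [← hg.sum_mul_ginv hx j p, Finset.sum_mul]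
    refine Finset.sum_congr rfl fun h _ => ?_
    rw [hg.symm h j x hx]
    ring
  simp [this]

/-- The metric is covariantly constant. -/
lemma IsMetric.pd_eq_sum_christoffel {r : WithTop ℕ∞} (hU : IsOpen U) (hg : IsMetric r g U)
    {x : Fin n → ℝ} (hx : x ∈ U) (i j k : Fin n) : pd k (g i j) x =
      ∑ h, Christoffel g h k i x * g h j x + ∑ h, Christoffel g h k j x * g h i x := by
  rw [hg.sum_christoffel_mul hx, hg.sum_christoffel_mul hx,
    pd_congr hU (hg.symm j i) hx]
  ring

variable {gbar : Fin n → Fin n → (Fin n → ℝ) → ℝ} {ψ : Fin n → (Fin n → ℝ) → ℝ}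

/-- The Levi-Civita equations of a geodesic mapping in terms of the derivatives of `ḡ`. -/
lemma GeodesicallyRelated.pd_eq {r : WithTop ℕ∞} (hU : IsOpen U) (hgbar : IsMetric r gbar U)
    (hgeo : GeodesicallyRelated g gbar ψ U) {x : Fin n → ℝ} (hx : x ∈ U) (i j k : Fin n) :
    pd k (gbar i j) x = 2 * (ψ k x * gbar i j x) + ψ i x * gbar k j x + ψ j x * gbar k i x
      + ∑ h, (Christoffel g h k i x * gbar h j x + Christoffel g h k j x * gbar h i x) := by
  rw [hgbar.pd_eq_sum_christoffel hU hx]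
  have key : ∀ i j, ∑ h, Christoffel gbar h k i x * gbar h j x
      = ∑ h, Christoffel g h k i x * gbar h j x + ψ k x * gbar i j x + ψ i x * gbar k j x := by
    intro i j
    simp [hgeo _ k i x hx, add_mul, Finset.sum_add_distrib]
  rw [key, key, hgbar.symm j i x hx, Finset.sum_add_distrib]
  ring

lemma GeodesicallyRelated.eq_sum_christoffel (hgeo : GeodesicallyRelated g gbar ψ U)
    {x : Fin n → ℝ} (hx : x ∈ U) (k : Fin n) :
    ψ k x = ((n : ℝ) + 1)⁻¹ * ∑ h, (Christoffel gbar h k h x - Christoffel g h k h x) := by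
  have : ∀ h, Christoffel gbar h k h x - Christoffel g h k h x
      = ψ k x + if h = k then ψ h x else 0 := by
    intro h
    rw [hgeo h k h x hx]
    by_cases hk : h = k <;> simp [hk]
    ring
  have hn : (n : ℝ) + 1 ≠ 0 := by positivity
  simp only [this, Finset.sum_add_distrib]
  simp
  field_simp

end Metric

section Contraction

variable {n : ℕ} {a b : Fin n → Fin n → ℝ}

lemma sum_sum_contract_both (hb : ∀ i j, b i j = b j i)
    (hab : ∀ i k, ∑ j, a i j * b j k = if i = k then 1 else 0)
    (hba : ∀ i k, ∑ j, b i j * a j k = if i = k then 1 else 0)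
    (T : Fin n → Fin n → ℝ) (k l : Fin n) :
    ∑ i, ∑ j, a i j * (2 * (T k l - T l k) * b i j + T i l * b k j + T j l * b k i
      - T i k * b l j - T j k * b l i) = (2 * n + 2) * (T k l - T l k) := by
  have h1 : ∀ c : ℝ, ∑ i, ∑ j, a i j * (c * b i j) = c * n := by
    intro c
    have : ∀ i, ∑ j, a i j * (c * b i j) = c := by
      intro i
      have := hab i i
      simp only [if_true] at this
      conv_rhs => rw [← mul_one c, ← this, Finset.mul_sum]
      exact Finset.sum_congr rfl fun j _ => by rw [hb i j]; ring
    simp [this, mul_comm]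
  have h2 : ∀ (X : Fin n → ℝ) k, ∑ i, ∑ j, a i j * (X i * b k j) = X k := by
    intro X k
    have : ∀ i, ∑ j, a i j * (X i * b k j) = X i * if i = k then 1 else 0 := by
      intro i
      rw [← hab i k, Finset.mul_sum]
      exact Finset.sum_congr rfl fun j _ => by rw [hb k j]; ring
    simp [this]
  have h3 : ∀ (X : Fin n → ℝ) k, ∑ i, ∑ j, a i j * (X j * b k i) = X k := by
    intro X k
    rw [Finset.sum_comm]
    have : ∀ j, ∑ i, a i j * (X j * b k i) = X j * if k = j then 1 else 0 := by
      intro j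
      rw [← hba k j, Finset.mul_sum]
      exact Finset.sum_congr rfl fun i _ => by ring
    simp [this]
  simp only [mul_add, mul_sub (a _ _), Finset.sum_add_distrib, Finset.sum_sub_distrib]
  rw [h1, h2 (fun i => T i l), h3 (fun i => T i l), h2 (fun i => T i k), h3 (fun i => T i k)]
  ring

lemma sum_sum_contract_each (hb : ∀ i j, b i j = b j i)
    (hab : ∀ i k, ∑ j, a i j * b j k = if i = k then 1 else 0)
    (T : Fin n → Fin n → ℝ) (k l p q : Fin n) :
    ∑ i, ∑ j, a p i * a q j * (T i l * b k j + T j l * b k i - T i k * b l j - T j k * b l i) =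
      (∑ i, a p i * T i l) * (if q = k then 1 else 0)
      + (∑ i, a q i * T i l) * (if p = k then 1 else 0)
      - (∑ i, a p i * T i k) * (if q = l then 1 else 0)
      - (∑ i, a q i * T i k) * (if p = l then 1 else 0) := by
  simp only [← hab, Finset.sum_mul_sum]
  have h2 : ∀ l k, ∑ i, ∑ j, a q i * T i l * (a p j * b j k)
      = ∑ i, ∑ j, a q j * T j l * (a p i * b i k) := fun l k => Finset.sum_comm
  rw [h2, h2]
  simp only [← Finset.sum_add_distrib, ← Finset.sum_sub_distrib]
  refine Finset.sum_congr rfl fun i _ => Finset.sum_congr rfl fun j _ => ?_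
  rw [hb k j, hb k i, hb l j, hb l i]
  ring

end Contraction

/-- Regularity gain for the Levi-Civita equations `∂_k b_{ij} = 2ψ_k b_{ij} + ψ_i b_{kj}
+ ψ_j b_{ki} + P_{kij}`: the integrability conditions determine the trace-free part of the
Jacobian of `b^{pi} ψ_i` up to terms of class `C^m`. -/
lemma IsMetric.contDiffOn_succ_of_leviCivita {n m : ℕ} (hn : 2 ≤ n) (hm : 1 ≤ m)
    {U : Set (Fin n → ℝ)} (hU : IsOpen U) {b : Fin n → Fin n → (Fin n → ℝ) → ℝ}
    {ψ : Fin n → (Fin n → ℝ) → ℝ} {P : Fin n → Fin n → Fin n → (Fin n → ℝ) → ℝ}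
    (hb : IsMetric (m + 1 : ℕ) b U) (hψ : ∀ i, ContDiffOn ℝ m (ψ i) U)
    (hP : ∀ k i j, ContDiffOn ℝ (m + 1 : ℕ) (P k i j) U)
    (heq : ∀ i j k, ∀ x ∈ U, pd k (b i j) x =
      2 * (ψ k x * b i j x) + ψ i x * b k j x + ψ j x * b k i x + P k i j x) (i j : Fin n) :
    ContDiffOn ℝ (m + 1 + 1 : ℕ) (b i j) U := by
  have hle : ((m : ℕ) : WithTop ℕ∞) ≤ (m + 1 : ℕ) := by norm_cast; lia
  have ha := hb.contDiffOn_ginv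
  have hb0 := fun i j => (hb.contDiff i j).of_le hle
  have ha0 := fun i j => (ha i j).of_le hle
  have dψ := fun i x (hx : x ∈ U) => (hψ i).differentiableAt_of_isOpen hU hm hx
  have db := fun i j x (hx : x ∈ U) => (hb0 i j).differentiableAt_of_isOpen hU hm hx
  have da := fun i j x (hx : x ∈ U) => (ha0 i j).differentiableAt_of_isOpen hU hm hx
  have dP := fun k i j x (hx : x ∈ U) =>
    (hP k i j).differentiableAt_of_isOpen hU (by lia) hx
  have hsecond : ∀ i j k l, ∀ x ∈ U, pd l (pd k (b i j)) x =
      2 * (pd l (ψ k) x * b i j x + ψ k x * pd l (b i j) x)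
      + (pd l (ψ i) x * b k j x + ψ i x * pd l (b k j) x)
      + (pd l (ψ j) x * b k i x + ψ j x * pd l (b k i) x) + pd l (P k i j) x := by
    intro i j k l x hx
    have e1 := (dψ k x hx).fun_mul (db i j x hx)
    have e2 := (dψ i x hx).fun_mul (db k j x hx)
    have e3 := (dψ j x hx).fun_mul (db k i x hx)
    rw [pd_congr hU (heq i j k) hx,
      pd_add l (((e1.const_mul 2).fun_add e2).fun_add e3) (dP k i j x hx),
      pd_add l ((e1.const_mul 2).fun_add e2) e3, pd_add l (e1.const_mul 2) e2,
      pd_const_mul l 2 e1, pd_mul l (dψ k x hx) (db i j x hx),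
      pd_mul l (dψ i x hx) (db k j x hx), pd_mul l (dψ j x hx) (db k i x hx)]
  have hint : ∀ i j k l, ContDiffOn ℝ m (fun x =>
      2 * (pd l (ψ k) x - pd k (ψ l) x) * b i j x + pd l (ψ i) x * b k j x
      + pd l (ψ j) x * b k i x - pd k (ψ i) x * b l j x - pd k (ψ j) x * b l i x) U := by
    intro i j k l
    have hL : ∀ k l, ContDiffOn ℝ m (fun x => 2 * (ψ k x * pd l (b i j) x)
        + ψ i x * pd l (b k j) x + ψ j x * pd l (b k i) x + pd l (P k i j) x) U := fun k l =>
      (((contDiffOn_const.mul ((hψ k).mul ((hb.contDiff i j).pd hU l))).add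
        ((hψ i).mul ((hb.contDiff k j).pd hU l))).add
        ((hψ j).mul ((hb.contDiff k i).pd hU l))).add ((hP k i j).pd hU l)
    refine ((hL l k).sub (hL k l)).congr fun x hx => ?_
    have hc := pd_comm hU ((hb.contDiff i j).of_le (by norm_cast; lia)) hx l k
    rw [hsecond i j k l x hx, hsecond i j l k x hx] at hc
    linarith
  have hclosed : ∀ k l, ContDiffOn ℝ m (fun x => pd l (ψ k) x - pd k (ψ l) x) U := by
    intro k l
    have := (contDiffOn_const (c := ((2 * n + 2 : ℝ))⁻¹)).mul (ContDiffOn.sum (s := Finset.univ)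
      fun i _ => ContDiffOn.sum (s := Finset.univ) fun j _ => (ha0 i j).mul (hint i j k l))
    refine this.congr fun x hx => ?_
    rw [sum_sum_contract_both (a := fun i j => ginv b i j x) (b := fun i j => b i j x)
      (fun i j => hb.symm i j x hx) (hb.sum_ginv_mul hx) (hb.sum_mul_ginv hx)
      (fun i l => pd l (ψ i) x)]
    field_simp
  have hcontract : ∀ k l p q, ContDiffOn ℝ m (fun x =>
      (∑ i, ginv b p i x * pd l (ψ i) x) * (if q = k then 1 else 0)
      + (∑ i, ginv b q i x * pd l (ψ i) x) * (if p = k then 1 else 0)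
      - (∑ i, ginv b p i x * pd k (ψ i) x) * (if q = l then 1 else 0)
      - (∑ i, ginv b q i x * pd k (ψ i) x) * (if p = l then 1 else 0)) U := by
    intro k l p q
    have := ContDiffOn.sum (s := Finset.univ) fun i _ => ContDiffOn.sum (s := Finset.univ)
      fun j _ => ((ha0 p i).mul (ha0 q j)).mul ((hint i j k l).sub
        ((contDiffOn_const (c := (2 : ℝ))).mul (hclosed k l) |>.mul (hb0 i j)))
    refine this.congr fun x hx => ?_
    rw [← sum_sum_contract_each (a := fun i j => ginv b i j x) (b := fun i j => b i j x)
      (fun i j => hb.symm i j x hx) (hb.sum_ginv_mul hx) (fun i l => pd l (ψ i) x)]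
    refine Finset.sum_congr rfl fun i _ => Finset.sum_congr rfl fun j _ => ?_
    ring
  set v : Fin n → (Fin n → ℝ) → ℝ := fun p x => ∑ i, ginv b p i x * ψ i x with hv
  have hvC : ∀ p, ContDiffOn ℝ m (v p) U := fun p =>
    ContDiffOn.sum fun i _ => (ha0 p i).mul (hψ i)
  have hrest : ∀ p l, ContDiffOn ℝ m (fun x => ∑ i, pd l (ginv b p i) x * ψ i x) U := fun p l =>
    ContDiffOn.sum fun i _ => ((ha p i).pd hU l).mul (hψ i)
  have hpdv : ∀ p l, ∀ x ∈ U, pd l (v p) x =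
      ∑ i, pd l (ginv b p i) x * ψ i x + ∑ i, ginv b p i x * pd l (ψ i) x := by
    intro p l x hx
    rw [pd_sum l fun i => (da p i x hx).fun_mul (dψ i x hx), ← Finset.sum_add_distrib]
    exact Finset.sum_congr rfl fun i _ => pd_mul l (da p i x hx) (dψ i x hx)
  have hvS : ∀ p, ContDiffOn ℝ (m + 1 : ℕ) (v p) U := by
    refine contDiffOn_succ_of_traceFree_pd hm hn hU
      (fun p => (hvC p).differentiableOn (by norm_cast; lia)) ?_ ?_
    · intro p l hpl
      refine ((hrest p l).add ((contDiffOn_const (c := (1 / 2 : ℝ))).mul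
        (hcontract p l p p))).congr fun x hx => ?_
      rw [hpdv p l x hx]
      simp [hpl]
      ring
    · intro p q
      rcases eq_or_ne p q with rfl | hpq
      · simpa using contDiffOn_const
      · refine (((hrest p p).sub (hrest q q)).add (hcontract q p p q)).congr fun x hx => ?_
        rw [hpdv p p x hx, hpdv q q x hx]
        simp [hpq, hpq.symm]
        ring
  have hψS : ∀ i, ContDiffOn ℝ (m + 1 : ℕ) (ψ i) U := by
    intro i
    refine (ContDiffOn.sum (s := Finset.univ)
      fun p _ => (hb.contDiff i p).mul (hvS p)).congr fun x hx => ?_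
    simp only [hv, Finset.mul_sum]
    rw [Finset.sum_comm]
    simp only [← mul_assoc, ← Finset.sum_mul, hb.sum_mul_ginv hx]
    simp
  refine contDiffOn_succ_of_pd hU (fun x hx => (db i j x hx).differentiableWithinAt) fun k => ?_
  exact (((((contDiffOn_const (c := (2 : ℝ))).mul ((hψS k).mul (hb.contDiff i j))).add
    ((hψS i).mul (hb.contDiff k j))).add ((hψS j).mul (hb.contDiff k i))).add
    (hP k i j)).congr (heq i j k)

/-- If `g ∈ C^r` (`r ≥ 2`) and `ḡ ∈ C^2` are geodesically related via a continuous
1-form `ψ` on an open set `U ⊆ ℝⁿ` (`n ≥ 2`), then `ḡ ∈ C^r`. -/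
theorem geodesic_mapping_C2_to_Cr
    {n : ℕ} (hn : 2 ≤ n) (U : Set (Fin n → ℝ)) (hU : IsOpen U)
    (r : ℕ) (hr : 2 ≤ r)
    (g gbar : Fin n → Fin n → (Fin n → ℝ) → ℝ)
    (hg : IsMetric r g U) (hgbar : IsMetric 2 gbar U)
    (ψ : Fin n → (Fin n → ℝ) → ℝ) (hψ : ∀ i, ContinuousOn (ψ i) U)
    (hgeo : GeodesicallyRelated g gbar ψ U) :
    ∀ i j, ContDiffOn ℝ r (gbar i j) U := by
  have step : ∀ m, m + 2 ≤ r → ∀ i j, ContDiffOn ℝ (m + 2 : ℕ) (gbar i j) U := by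
    intro m
    induction m with
    | zero => exact fun _ => hgbar.contDiff
    | succ m ih =>
      intro hmr
      have hb : IsMetric (m + 1 + 1 : ℕ) gbar U := ⟨hgbar.symm, ih (by lia), hgbar.inv⟩
      have hΓ : ∀ h i j, ContDiffOn ℝ (m + 1 + 1 : ℕ) (Christoffel g h i j) U :=
        (hg.of_le (by norm_cast)).contDiffOn_christoffel hU
      have hψC : ∀ k, ContDiffOn ℝ (m + 1 : ℕ) (ψ k) U := fun k =>
        (contDiffOn_const.mul (ContDiffOn.sum fun h _ =>
          (hb.contDiffOn_christoffel hU h k h).sub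
            ((hΓ h k h).of_le (by norm_cast; lia)))).congr fun x hx =>
              hgeo.eq_sum_christoffel hx k
      exact hb.contDiffOn_succ_of_leviCivita hn (by lia) hU hψC
        (fun k i j => ContDiffOn.sum fun h _ =>
          ((hΓ h k i).mul (hb.contDiff h j)).add ((hΓ h k j).mul (hb.contDiff h i)))
        fun i j k x hx => hgeo.pd_eq hU hb hx i j k
  obtain ⟨m, rfl⟩ := Nat.exists_eq_add_of_le' hr
  exact step m le_rfl
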